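/- arXiv:2108.03276 — 2 statements merged into one kernel-verified Lean document; each statement's English description precedes it below -/
import Mathlib

section
/- Let n ∈ ℕ with n ≥ 1, let μ ∈ ℂ with Re μ > −1/2, and let x, x' ∈ (−1,1) with x ≠ x'. Then the Christoffel–Darboux formula Σ_{k=0}^{n−1} ((2μ+2k+1) Γ(2μ+k+1)/k!) 𝖯_{k+μ}^{−μ}(x) 𝖯_{k+μ}^{−μ}(x') = (Γ(2μ+n+1)/((n−1)!(x−x'))) ( 𝖯_{n+μ}^{−μ}(x) 𝖯_{n+μ−1}^{−μ}(x') − 𝖯_{n+μ−1}^{−μ}(x) 𝖯_{n+μ}^{−μ}(x') ) holds. -/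
/-- Pochhammer symbol `(a)_k = a (a+1) ⋯ (a+k-1)` for complex `a`. -/
noncomputable def cpoch (a : ℂ) (k : ℕ) : ℂ := ∏ i ∈ Finset.range k, (a + i)

/-- Gauss hypergeometric series `₂F₁(a, b; c; z)`. -/
noncomputable def hyp2F1 (a b c z : ℂ) : ℂ :=
  ∑' k : ℕ, cpoch a k * cpoch b k / (cpoch c k * (Nat.factorial k : ℂ)) * z ^ k

/-- Ferrers function of the first kind `𝖯_ν^{−μ}(x)`. -/
noncomputable def ferrersP (ν μ : ℂ) (x : ℝ) : ℂ :=
  (1 / Complex.Gamma (μ + 1)) * (((1 - x) / (1 + x) : ℝ) : ℂ) ^ (μ / 2) *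
    hyp2F1 (-ν) (ν + 1) (μ + 1) (((1 - x) / 2 : ℝ) : ℂ)

open Filter Topology

theorem cpoch_succ (a : ℂ) (k : ℕ) : cpoch a (k + 1) = cpoch a k * (a + k) :=
  Finset.prod_range_succ _ _

theorem cpoch_succ_left (a : ℂ) (k : ℕ) : cpoch a (k + 1) = a * cpoch (a + 1) k := by
  simp only [cpoch, Finset.prod_range_succ']
  rw [mul_comm]
  congr 1
  · simp
  · refine Finset.prod_congr rfl fun i _ => ?_
    push_cast
    ring

/-- The Gauss hypergeometric series converges in the open unit disc. -/
theorem summable_hyp2F1 (a b c : ℂ) {z : ℂ} (hz : ‖z‖ < 1) :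
    Summable fun k : ℕ =>
      cpoch a k * cpoch b k / (cpoch c k * (Nat.factorial k : ℂ)) * z ^ k := by
  obtain ⟨r, hzr, hr⟩ := exists_between hz
  have h₁ := tendsto_add_mul_div_add_mul_atTop_nhds a c (1 : ℂ) (one_ne_zero (α := ℂ))
  have h₂ := tendsto_add_mul_div_add_mul_atTop_nhds b 1 (1 : ℂ) (one_ne_zero (α := ℂ))
  have h := ((h₁.mul h₂).mul_const z).norm
  simp only [one_mul, div_one] at h
  refine summable_of_ratio_norm_eventually_le hr ?_
  filter_upwards [h.eventually_lt_const hzr] with k hk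
  have hstep : cpoch a (k + 1) * cpoch b (k + 1) /
        (cpoch c (k + 1) * (Nat.factorial (k + 1) : ℂ)) * z ^ (k + 1) =
      (a + k) / (c + k) * ((b + k) / (1 + k)) * z *
        (cpoch a k * cpoch b k / (cpoch c k * (Nat.factorial k : ℂ)) * z ^ k) := by
    rw [cpoch_succ, cpoch_succ, cpoch_succ, Nat.factorial_succ]
    push_cast
    simp only [div_eq_mul_inv, mul_inv, pow_succ, add_comm (1 : ℂ)]
    ring
  rw [hstep, norm_mul]
  exact mul_le_mul_of_nonneg_right hk.le (norm_nonneg _)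

theorem cpoch_ne_zero {c : ℂ} (hc : ∀ k : ℕ, c + k ≠ 0) (k : ℕ) : cpoch c k ≠ 0 :=
  Finset.prod_ne_zero_iff.mpr fun i _ => hc i

theorem legendre_coeff_recurrence (ν : ℂ) {c : ℂ} (hc : ∀ k : ℕ, c + k ≠ 0) (j : ℕ) :
    (ν + c) * (cpoch (-(ν + 1)) (j + 1) * cpoch (ν + 1 + 1) (j + 1) /
          (cpoch c (j + 1) * (Nat.factorial (j + 1) : ℂ))) +
        (ν - c + 1) * (cpoch (-(ν - 1)) (j + 1) * cpoch (ν - 1 + 1) (j + 1) /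
          (cpoch c (j + 1) * (Nat.factorial (j + 1) : ℂ))) -
        (2 * ν + 1) * (cpoch (-ν) (j + 1) * cpoch (ν + 1) (j + 1) /
          (cpoch c (j + 1) * (Nat.factorial (j + 1) : ℂ))) =
      -2 * (2 * ν + 1) * (cpoch (-ν) j * cpoch (ν + 1) j /
          (cpoch c j * (Nat.factorial j : ℂ))) := by
  cases j with
  | zero =>
    have h0 : c ≠ 0 := by simpa using hc 0
    simp [cpoch]
    field_simp
    ring
  | succ m =>
    have e₁ : cpoch (-(ν + 1)) (m + 1 + 1) = -(ν + 1) * (-ν * cpoch (-ν + 1) m) := by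
      rw [cpoch_succ_left, show -(ν + 1) + 1 = -ν by ring, cpoch_succ_left]
    have e₂ : cpoch (ν - 1 + 1) (m + 1 + 1) = ν * ((ν + 1) * cpoch (ν + 1 + 1) m) := by
      rw [sub_add_cancel, cpoch_succ_left, cpoch_succ_left]
    have e₃ : cpoch (-(ν - 1)) (m + 1 + 1) =
        cpoch (-ν + 1) m * (-ν + 1 + m) * (-ν + 1 + (m + 1 : ℕ)) := by
      rw [show -(ν - 1) = -ν + 1 by ring, cpoch_succ, cpoch_succ]
    rw [e₁, e₂, e₃, cpoch_succ_left (-ν) (m + 1), cpoch_succ_left (ν + 1) (m + 1),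
      cpoch_succ_left (-ν) m, cpoch_succ_left (ν + 1) m, cpoch_succ (-ν + 1) m,
      cpoch_succ (ν + 1 + 1) (m + 1), cpoch_succ (ν + 1 + 1) m, cpoch_succ c (m + 1),
      Nat.factorial_succ (m + 1)]
    have hp := cpoch_ne_zero hc (m + 1)
    have hcm := hc (m + 1)
    have hf : (Nat.factorial (m + 1) : ℂ) ≠ 0 := by exact_mod_cast Nat.factorial_ne_zero _
    have hm : (m : ℂ) + 1 + 1 ≠ 0 := by exact_mod_cast (Nat.succ_ne_zero (m + 1))
    push_cast at hcm ⊢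
    field_simp
    ring

/-- The three-term contiguous relation for `₂F₁(-ν, ν + 1; c; z)`. -/
theorem hyp2F1_recurrence (ν : ℂ) {c z : ℂ} (hc : ∀ k : ℕ, c + k ≠ 0) (hz : ‖z‖ < 1) :
    (ν + c) * hyp2F1 (-(ν + 1)) (ν + 1 + 1) c z =
      (2 * ν + 1) * (1 - 2 * z) * hyp2F1 (-ν) (ν + 1) c z -
        (ν - c + 1) * hyp2F1 (-(ν - 1)) (ν - 1 + 1) c z := by
  have s₁ := summable_hyp2F1 (-(ν + 1)) (ν + 1 + 1) c hz
  have s₂ := summable_hyp2F1 (-ν) (ν + 1) c hz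
  have s₃ := summable_hyp2F1 (-(ν - 1)) (ν - 1 + 1) c hz
  have h := ((s₁.hasSum.mul_left (ν + c)).add (s₃.hasSum.mul_left (ν - c + 1))).sub
    (s₂.hasSum.mul_left (2 * ν + 1))
  have h0 := h.tsum_eq
  rw [h.summable.tsum_eq_zero_add] at h0
  have hshift := s₂.hasSum.mul_left (-2 * (2 * ν + 1) * z)
  have hterm : ∀ j : ℕ, _ := fun j : ℕ =>
    congrArg (· * z ^ (j + 1)) (legendre_coeff_recurrence ν hc j)
  rw [tsum_congr fun j : ℕ => ?_, hshift.tsum_eq] at h0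
  rotate_left
  · linear_combination hterm j
  simp only [cpoch, Finset.range_zero, Finset.prod_empty, Nat.factorial_zero, pow_zero] at h0
  simp only [hyp2F1, cpoch]
  linear_combination -h0

theorem ferrersP_recurrence (ν : ℂ) {μ : ℂ} (hμ : ∀ k : ℕ, μ + 1 + k ≠ 0) {x : ℝ}
    (hx : x ∈ Set.Ioo (-1 : ℝ) 1) :
    (ν + μ + 1) * ferrersP (ν + 1) μ x =
      (2 * ν + 1) * x * ferrersP ν μ x - (ν - μ) * ferrersP (ν - 1) μ x := by
  have hz : ‖(((1 - x) / 2 : ℝ) : ℂ)‖ < 1 := by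
    rw [Complex.norm_real, Real.norm_eq_abs, abs_lt]
    constructor <;> linarith [hx.1, hx.2]
  have h := hyp2F1_recurrence ν hμ hz
  have hxz : 1 - 2 * (((1 - x) / 2 : ℝ) : ℂ) = x := by
    push_cast
    ring
  rw [hxz] at h
  unfold ferrersP
  linear_combination (1 / Complex.Gamma (μ + 1)) *
    (((1 - x) / (1 + x) : ℝ) : ℂ) ^ (μ / 2) * h

theorem ferrersP_christoffel_darboux (n : ℕ) (hn : 1 ≤ n) (μ : ℂ)
    (hμ : -(1 / 2 : ℝ) < μ.re) (x x' : ℝ) (hx : x ∈ Set.Ioo (-1 : ℝ) 1)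
    (hx' : x' ∈ Set.Ioo (-1 : ℝ) 1) (hxx : x ≠ x') :
    ∑ k ∈ Finset.range n,
        ((2 * μ + 2 * k + 1) * Complex.Gamma (2 * μ + k + 1) / (Nat.factorial k : ℂ)) *
          ferrersP ((k : ℂ) + μ) μ x * ferrersP ((k : ℂ) + μ) μ x' =
      Complex.Gamma (2 * μ + n + 1) / ((Nat.factorial (n - 1) : ℂ) * ((x : ℂ) - (x' : ℂ))) *
        (ferrersP ((n : ℂ) + μ) μ x * ferrersP ((n : ℂ) + μ - 1) μ x' -
          ferrersP ((n : ℂ) + μ - 1) μ x * ferrersP ((n : ℂ) + μ) μ x') := by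
  have hc : ∀ k : ℕ, μ + 1 + k ≠ 0 := fun k h => by
    have := congrArg Complex.re h
    simp at this
    have hk : (0 : ℝ) ≤ k := k.cast_nonneg
    linarith
  have hsub : (x : ℂ) - (x' : ℂ) ≠ 0 := sub_ne_zero.mpr (by exact_mod_cast hxx)
  induction n, hn using Nat.le_induction with
  | base =>
    have h := ferrersP_recurrence μ hc hx
    have h' := ferrersP_recurrence μ hc hx'
    have hg : 2 * μ + 1 ≠ 0 := fun h => by
      have := congrArg Complex.re h
      simp at this
      linarith
    have hG := Complex.Gamma_add_one (2 * μ + 1) hg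
    have hP : ferrersP (μ + 1) μ x = x * ferrersP μ μ x :=
      mul_left_cancel₀ hg (by linear_combination h)
    have hP' : ferrersP (μ + 1) μ x' = x' * ferrersP μ μ x' :=
      mul_left_cancel₀ hg (by linear_combination h')
    simp only [Finset.sum_range_one, Nat.cast_zero, Nat.cast_one, Nat.factorial_zero,
      Nat.sub_self, mul_zero, add_zero, zero_add, add_comm (1 : ℂ) μ, add_sub_cancel_right,
      div_one, one_mul]
    rw [hG, hP, hP']
    field_simp
  | succ m hm ih =>
    obtain ⟨m, rfl⟩ := Nat.exists_eq_add_of_le' hm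
    have h := ferrersP_recurrence ((m + 1 : ℕ) + μ) hc hx
    have h' := ferrersP_recurrence ((m + 1 : ℕ) + μ) hc hx'
    have hg : 2 * μ + (m + 1 : ℕ) + 1 ≠ 0 := fun h => by
      have := congrArg Complex.re h
      simp at this
      have hk : (0 : ℝ) ≤ m := m.cast_nonneg
      linarith
    have hG := Complex.Gamma_add_one (2 * μ + (m + 1 : ℕ) + 1) hg
    have hf : (Nat.factorial m : ℂ) ≠ 0 := by exact_mod_cast Nat.factorial_ne_zero _
    have hm1 : (m : ℂ) + 1 ≠ 0 := by exact_mod_cast m.succ_ne_zero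
    rw [Finset.sum_range_succ, ih]
    have e₁ : ((m + 1 + 1 : ℕ) : ℂ) + μ = (m + 1 : ℕ) + μ + 1 := by
      push_cast
      ring
    have e₂ : 2 * μ + ((m + 1 + 1 : ℕ) : ℂ) + 1 = 2 * μ + (m + 1 : ℕ) + 1 + 1 := by
      push_cast
      ring
    rw [e₁, e₂, hG, add_sub_cancel_right]
    simp only [Nat.add_sub_cancel, Nat.factorial_succ m]
    generalize ferrersP ((m + 1 : ℕ) + μ + 1) μ x = A at *
    generalize ferrersP ((m + 1 : ℕ) + μ + 1) μ x' = A' at *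
    generalize ferrersP ((m + 1 : ℕ) + μ - 1) μ x = B at *
    generalize ferrersP ((m + 1 : ℕ) + μ - 1) μ x' = B' at *
    generalize ferrersP ((m + 1 : ℕ) + μ) μ x = C at *
    generalize ferrersP ((m + 1 : ℕ) + μ) μ x' = C' at *
    generalize Complex.Gamma (2 * μ + (m + 1 : ℕ) + 1) = G at *
    push_cast at h h' ⊢
    field_simp
    linear_combination G * (C * h' - C' * h)
end

section
/- Let λ be real with λ > −1/2 and let z be real with z > 0. Then the Mehler–Heine-type limit lim_{n→∞} n^{λ} 𝖯_{n+λ}^{−λ}(1 − z²/(2n²)) = J_{λ}(z) holds, where the limit is taken over integers n large enough that 1 − z²/(2n²) ∈ (−1,1). -/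
/-- Bessel function of the first kind `J_λ(z)` for real `z > 0`. -/
noncomputable def besselJ (lam : ℂ) (z : ℝ) : ℂ :=
  ∑' k : ℕ, (-1) ^ k * ((z / 2 : ℝ) : ℂ) ^ (lam + 2 * k) /
    ((Nat.factorial k : ℂ) * Complex.Gamma (lam + k + 1))

open Filter Topology

/-- The ratio of consecutive terms of `₂F₁(a, b; c; w)`. -/
noncomputable def hypRatio (a b c w : ℂ) (i : ℕ) : ℂ :=
  (a + i) * (b + i) * w / ((c + i) * (i + 1))

theorem hyp2F1_eq_tsum_prod (a b c w : ℂ) :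
    hyp2F1 a b c w = ∑' k : ℕ, ∏ i ∈ Finset.range k, hypRatio a b c w i := by
  unfold hyp2F1
  congr 1
  ext k
  have hfac : ((Nat.factorial k : ℕ) : ℂ) = ∏ i ∈ Finset.range k, ((i : ℂ) + 1) := by
    rw [← Finset.prod_range_add_one_eq_factorial]
    push_cast
    rfl
  simp only [cpoch, hypRatio, Finset.prod_div_distrib, Finset.prod_mul_distrib,
    Finset.prod_const, Finset.card_range, hfac]
  ring

theorem Gamma_add_natCast_add_one {lam : ℝ} (hlam : -1 < lam) (k : ℕ) :
    Complex.Gamma (lam + k + 1) =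
      Complex.Gamma (lam + 1) * ∏ i ∈ Finset.range k, ((lam : ℂ) + 1 + i) := by
  induction k with
  | zero => simp
  | succ k ih =>
    have hne : (lam : ℂ) + k + 1 ≠ 0 := by
      have : (0 : ℝ) < lam + k + 1 := by
        have := k.cast_nonneg (α := ℝ)
        linarith
      exact_mod_cast this.ne'
    rw [Finset.prod_range_succ, ← mul_assoc, ← ih]
    have := Complex.Gamma_add_one _ hne
    push_cast
    rw [show (lam : ℂ) + (k + 1) + 1 = lam + k + 1 + 1 by ring, this]
    ring

theorem besselJ_eq_tsum_prod {lam : ℝ} (hlam : -1 < lam) {z : ℝ} (hz : 0 < z) :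
    besselJ lam z = 1 / Complex.Gamma (lam + 1) * (((z / 2) ^ lam : ℝ) : ℂ) *
      ∑' k : ℕ, ∏ i ∈ Finset.range k,
        (-((z : ℂ) ^ 2 / 4) / (((lam : ℂ) + 1 + i) * (i + 1))) := by
  unfold besselJ
  rw [← tsum_mul_left]
  congr 1
  ext k
  have hfac : ((Nat.factorial k : ℕ) : ℂ) = ∏ i ∈ Finset.range k, ((i : ℂ) + 1) := by
    rw [← Finset.prod_range_add_one_eq_factorial]
    push_cast
    rfl
  have hz2 : ((z / 2 : ℝ) : ℂ) ≠ 0 := by exact_mod_cast (half_pos hz).ne'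
  have hpow : ((z / 2 : ℝ) : ℂ) ^ ((lam : ℂ) + 2 * k) =
      (((z / 2) ^ lam : ℝ) : ℂ) * ((z : ℂ) ^ 2 / 4) ^ k := by
    rw [Complex.cpow_add _ _ hz2, ← Complex.ofReal_cpow (half_pos hz).le]
    congr 1
    rw [show (2 : ℂ) * k = ((2 * k : ℕ) : ℂ) by push_cast; rfl, Complex.cpow_natCast, pow_mul]
    push_cast
    ring
  rw [hpow, Gamma_add_natCast_add_one hlam, hfac, Finset.prod_div_distrib,
    Finset.prod_mul_distrib, Finset.prod_const, Finset.card_range, neg_pow ((z : ℂ) ^ 2 / 4)]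
  field_simp

theorem tendsto_ferrersP_prefactor (lam : ℝ) {z : ℝ} (hz : 0 < z) :
    Tendsto (fun n : ℕ => (n : ℂ) ^ (lam : ℂ) *
      (((1 - (1 - z ^ 2 / (2 * (n : ℝ) ^ 2))) / (1 + (1 - z ^ 2 / (2 * (n : ℝ) ^ 2))) : ℝ) : ℂ)
        ^ ((lam : ℂ) / 2)) atTop (𝓝 (((z / 2) ^ lam : ℝ) : ℂ)) := by
  have hsmall : Tendsto (fun n : ℕ => 2 - z ^ 2 / (2 * (n : ℝ) ^ 2)) atTop (𝓝 2) := by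
    have hsq : Tendsto (fun n : ℕ => 2 * (n : ℝ) ^ 2) atTop atTop :=
      ((tendsto_pow_atTop two_ne_zero).comp tendsto_natCast_atTop_atTop).const_mul_atTop two_pos
    simpa using (hsq.const_div_atTop (z ^ 2)).const_sub 2
  have hlim : Tendsto (fun n : ℕ => (z ^ 2 / 2 / (2 - z ^ 2 / (2 * (n : ℝ) ^ 2))) ^ (lam / 2))
      atTop (𝓝 ((z / 2) ^ lam)) := by
    have h := ((hsmall.inv₀ two_ne_zero).const_mul (z ^ 2 / 2)).rpow_const (p := lam / 2)
      (Or.inl (by positivity))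
    simp only [← div_eq_mul_inv] at h
    convert h using 2
    rw [show z ^ 2 / 2 / 2 = (z / 2) ^ (2 : ℝ) by rw [Real.rpow_two]; ring,
      ← Real.rpow_mul (half_pos hz).le]
    congr 1
    ring
  refine ((Complex.continuous_ofReal.tendsto _).comp hlim).congr' ?_
  filter_upwards [hsmall.eventually (lt_mem_nhds two_pos), eventually_gt_atTop 0] with n hn hn0
  have hn0' : (0 : ℝ) < n := Nat.cast_pos.mpr hn0
  have hA : 0 ≤ (1 - (1 - z ^ 2 / (2 * (n : ℝ) ^ 2))) / (1 + (1 - z ^ 2 / (2 * (n : ℝ) ^ 2))) := by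
    apply div_nonneg
    · rw [sub_sub_cancel]
      positivity
    · linarith
  have hnpow : (n : ℝ) ^ lam = ((n : ℝ) ^ 2) ^ (lam / 2) := by
    rw [← Real.rpow_two, ← Real.rpow_mul hn0'.le]
    congr 1
    ring
  rw [show (lam : ℂ) / 2 = ((lam / 2 : ℝ) : ℂ) by push_cast; rfl, ← Complex.ofReal_cpow hA,
    show (n : ℂ) = ((n : ℝ) : ℂ) by norm_cast, ← Complex.ofReal_cpow hn0'.le,
    ← Complex.ofReal_mul, hnpow, ← Real.mul_rpow (by positivity) hA]
  simp only [Function.comp]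
  congr 2
  rw [sub_sub_cancel, show 1 + (1 - z ^ 2 / (2 * (n : ℝ) ^ 2)) = 2 - z ^ 2 / (2 * (n : ℝ) ^ 2) by
    ring]
  field_simp

theorem tendsto_hypRatio (lam z : ℝ) (i : ℕ) :
    Tendsto (fun n : ℕ => hypRatio (-((n : ℂ) + lam)) ((n : ℂ) + lam + 1) ((lam : ℂ) + 1)
      (((1 - (1 - z ^ 2 / (2 * (n : ℝ) ^ 2))) / 2 : ℝ) : ℂ) i) atTop
      (𝓝 (-((z : ℂ) ^ 2 / 4) / (((lam : ℂ) + 1 + i) * (i + 1)))) := by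
  have hinv : Tendsto (fun n : ℕ => ((n : ℂ))⁻¹) atTop (𝓝 0) := tendsto_inv_atTop_nhds_zero_nat
  have h1 := (hinv.mul_const (-(lam : ℂ) + i)).const_add (-1)
  have h2 := (hinv.mul_const ((lam : ℂ) + 1 + i)).const_add 1
  have h := (((h1.mul h2).mul_const ((z : ℂ) ^ 2 / 4)).div_const
    (((lam : ℂ) + 1 + i) * (i + 1)))
  have hval : ((-1 + 0 * (-(lam : ℂ) + i)) * (1 + 0 * ((lam : ℂ) + 1 + i)) * ((z : ℂ) ^ 2 / 4)) =
      -((z : ℂ) ^ 2 / 4) := by ring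
  rw [hval] at h
  refine h.congr' ?_
  filter_upwards [eventually_gt_atTop 0] with n hn
  have hn' : (n : ℂ) ≠ 0 := Nat.cast_ne_zero.mpr hn.ne'
  unfold hypRatio
  congr 1
  push_cast
  field_simp
  ring

/-- A bound for the term ratios which is uniform in the degree `n ≥ N`. -/
noncomputable def ratioBound (lam z : ℝ) (N i : ℕ) : ℝ :=
  z ^ 2 / 2 * ((2 + |lam|) / (i + 1) + 1 / N) ^ 2

theorem norm_hypRatio_le {lam : ℝ} (hlam : -(1 / 2 : ℝ) < lam) (z : ℝ) {N n : ℕ} (hN : 0 < N)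
    (hn : N ≤ n) (i : ℕ) :
    ‖hypRatio (-((n : ℂ) + lam)) ((n : ℂ) + lam + 1) ((lam : ℂ) + 1)
      (((1 - (1 - z ^ 2 / (2 * (n : ℝ) ^ 2))) / 2 : ℝ) : ℂ) i‖ ≤ ratioBound lam z N i := by
  have hN' : (0 : ℝ) < N := Nat.cast_pos.mpr hN
  have hn' : (N : ℝ) ≤ n := Nat.cast_le.mpr hn
  have hn0 : (0 : ℝ) < n := hN'.trans_le hn'
  have hn1 : (1 : ℝ) ≤ n := by exact_mod_cast hN.trans_le hn
  have hi : (0 : ℝ) ≤ i := i.cast_nonneg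
  have habs := abs_nonneg lam
  have hle := le_abs_self lam
  have hge := neg_abs_le lam
  have hreal : hypRatio (-((n : ℂ) + lam)) ((n : ℂ) + lam + 1) ((lam : ℂ) + 1)
      (((1 - (1 - z ^ 2 / (2 * (n : ℝ) ^ 2))) / 2 : ℝ) : ℂ) i =
      (((-(n + lam) + i) * (n + lam + 1 + i) * ((1 - (1 - z ^ 2 / (2 * (n : ℝ) ^ 2))) / 2) /
        ((lam + 1 + i) * (i + 1)) : ℝ) : ℂ) := by
    unfold hypRatio
    push_cast
    rfl
  have hw : (1 - (1 - z ^ 2 / (2 * (n : ℝ) ^ 2))) / 2 = z ^ 2 / (4 * (n : ℝ) ^ 2) := by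
    field_simp
    ring
  have hden : 0 < (lam + 1 + i) * ((i : ℝ) + 1) := mul_pos (by linarith) (by linarith)
  rw [hreal, Complex.norm_real, Real.norm_eq_abs, hw, abs_div, abs_mul, abs_mul,
    abs_of_pos hden, abs_of_nonneg (show 0 ≤ z ^ 2 / (4 * (n : ℝ) ^ 2) by positivity)]
  set S : ℝ := n + |lam| + 1 + i
  have hS : 0 ≤ S := by positivity
  have h1 : |-(n + lam) + (i : ℝ)| ≤ S := abs_le.mpr ⟨by simp only [S]; linarith, by
    simp only [S]; linarith⟩
  have h2 : |n + lam + 1 + (i : ℝ)| ≤ S := abs_le.mpr ⟨by simp only [S]; linarith, by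
    simp only [S]; linarith⟩
  have hden_le : ((i : ℝ) + 1) ^ 2 / 2 ≤ (lam + 1 + i) * ((i : ℝ) + 1) := by nlinarith
  have hSle : S / (n * (i + 1)) ≤ (2 + |lam|) / (i + 1) + 1 / N := by
    have hinv : 1 / (n : ℝ) ≤ 1 / N := one_div_le_one_div_of_le hN' hn'
    have : S / (n * (i + 1)) ≤ (2 + |lam|) / (i + 1) + 1 / n := by
      rw [div_add_div _ _ (by positivity) hn0.ne', mul_comm (n : ℝ)]
      gcongr
      simp only [S]
      nlinarith
    linarith
  calc |-(n + lam) + (i : ℝ)| * |n + lam + 1 + (i : ℝ)| * (z ^ 2 / (4 * (n : ℝ) ^ 2)) /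
        ((lam + 1 + i) * (i + 1))
      ≤ S * S * (z ^ 2 / (4 * (n : ℝ) ^ 2)) / (((i : ℝ) + 1) ^ 2 / 2) := by gcongr
    _ = z ^ 2 / 2 * (S / (n * (i + 1))) ^ 2 := by
      field_simp
      ring
    _ ≤ ratioBound lam z N i := by
      unfold ratioBound
      gcongr

theorem summable_prod_ratioBound (lam : ℝ) {z : ℝ} {N : ℕ} (hz : 0 < z) (hN : z < N) :
    Summable fun k : ℕ => ∏ i ∈ Finset.range k, ratioBound lam z N i := by
  have hN' : (0 : ℝ) < N := hz.trans hN
  have hpos : ∀ i, 0 < ratioBound lam z N i := fun i => by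
    unfold ratioBound
    positivity
  have hlim : Tendsto (ratioBound lam z N) atTop (𝓝 (z ^ 2 / 2 * (0 + 1 / N) ^ 2)) := by
    have h0 : Tendsto (fun i : ℕ => (2 + |lam|) / ((i : ℝ) + 1)) atTop (𝓝 0) :=
      (tendsto_atTop_add_const_right _ 1 tendsto_natCast_atTop_atTop).const_div_atTop _
    exact ((h0.add_const _).pow 2).const_mul _
  have hlt : z ^ 2 / 2 * (0 + 1 / (N : ℝ)) ^ 2 < 1 := by
    have : z ^ 2 / 2 * (0 + 1 / (N : ℝ)) ^ 2 = z ^ 2 / (2 * (N : ℝ) ^ 2) := by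
      field_simp
      ring
    rw [this, div_lt_one (by positivity)]
    nlinarith
  refine summable_of_ratio_test_tendsto_lt_one hlt
    (Eventually.of_forall fun k => (Finset.prod_pos fun i _ => hpos i).ne')
    (hlim.congr fun k => ?_)
  have hk : 0 < ∏ i ∈ Finset.range k, ratioBound lam z N i := Finset.prod_pos fun i _ => hpos i
  rw [Finset.prod_range_succ, norm_mul, mul_div_cancel_left₀ _ (norm_pos_iff.mpr hk.ne').ne',
    Real.norm_of_nonneg (hpos k).le]

theorem tendsto_hyp2F1 {lam : ℝ} (hlam : -(1 / 2 : ℝ) < lam) {z : ℝ} (hz : 0 < z) :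
    Tendsto (fun n : ℕ => hyp2F1 (-((n : ℂ) + lam)) ((n : ℂ) + lam + 1) ((lam : ℂ) + 1)
      (((1 - (1 - z ^ 2 / (2 * (n : ℝ) ^ 2))) / 2 : ℝ) : ℂ)) atTop
      (𝓝 (∑' k : ℕ, ∏ i ∈ Finset.range k,
        (-((z : ℂ) ^ 2 / 4) / (((lam : ℂ) + 1 + i) * (i + 1))))) := by
  obtain ⟨N, hN⟩ := exists_nat_gt z
  have hN0 : 0 < N := by exact_mod_cast hz.trans hN
  simp only [hyp2F1_eq_tsum_prod]
  refine tendsto_tsum_of_dominated_convergence (summable_prod_ratioBound lam hz hN)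
    (fun k => tendsto_finsetProd _ fun i _ => tendsto_hypRatio lam z i) ?_
  filter_upwards [eventually_ge_atTop N] with n hn k
  rw [norm_prod]
  exact Finset.prod_le_prod (fun _ _ => norm_nonneg _)
    fun i _ => norm_hypRatio_le hlam z hN0 hn i

theorem ferrersP_mehler_heine (lam : ℝ) (hlam : -(1 / 2 : ℝ) < lam) (z : ℝ) (hz : 0 < z) :
    Filter.Tendsto
      (fun n : ℕ =>
        (n : ℂ) ^ (lam : ℂ) *
          ferrersP ((n : ℂ) + lam) (lam : ℂ) (1 - z ^ 2 / (2 * (n : ℝ) ^ 2)))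
      Filter.atTop (nhds (besselJ (lam : ℂ) z)) := by
  rw [besselJ_eq_tsum_prod (by linarith) hz]
  refine (((tendsto_ferrersP_prefactor lam hz).const_mul (1 / Complex.Gamma (lam + 1))).mul
    (tendsto_hyp2F1 hlam hz)).congr fun n => ?_
  unfold ferrersP
  ring
end
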